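/- Let n ≥ 1 and let T be an n×n real matrix that is symmetric, tridiagonal (T i j = 0 whenever |i − j| > 1), strictly row diagonally dominant (for every row k, |T k k| > Σ_{j ≠ k} |T k j|), and has all diagonal entries positive (T k k > 0 for all k). Let U be an upper bidiagonal n×n real matrix (U i j = 0 unless j = i or j = i + 1) with positive diagonal entries such that Uᵀ U = T (U is the Cholesky factor of T). Then U is strictly diagonally dominant: for every k with k + 1 < n, |U k k| > |U k (k+1)|. -/

import Mathlib

open Matrix

/-- The superdiagonal entries of `Uᵀ * U` for an upper bidiagonal matrix `U`. -/
theorem transpose_mul_self_apply_succ_of_upperBidiagonal {n : ℕ} {U : Matrix (Fin n) (Fin n) ℝ}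
    (hbid : ∀ i j : Fin n, j ≠ i → (j : ℕ) ≠ (i : ℕ) + 1 → U i j = 0)
    {k l : Fin n} (hkl : (l : ℕ) = k + 1) : (Uᵀ * U) k l = U k k * U k l := by
  rw [Matrix.mul_apply, Finset.sum_eq_single k]
  · rfl
  · intro i _ hi
    by_cases hil : l = i
    · have : U i k = 0 := hbid i k (Ne.symm hi) (by subst hil; omega)
      simp [this]
    · have : U i l = 0 := hbid i l hil (by have := Fin.val_ne_of_ne hi; omega)
      simp [this]
  · simp

/-- The first diagonal entry of `Uᵀ * U` for an upper bidiagonal matrix `U`. -/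
theorem transpose_mul_self_apply_zero_of_upperBidiagonal {n : ℕ} {U : Matrix (Fin n) (Fin n) ℝ}
    (hbid : ∀ i j : Fin n, j ≠ i → (j : ℕ) ≠ (i : ℕ) + 1 → U i j = 0)
    {k : Fin n} (hk : (k : ℕ) = 0) : (Uᵀ * U) k k = U k k ^ 2 := by
  rw [Matrix.mul_apply, Finset.sum_eq_single k]
  · rw [Matrix.transpose_apply, sq]
  · intro i _ hi
    have : U i k = 0 := hbid i k (Ne.symm hi) (by omega)
    simp [this]
  · simp

/-- The other diagonal entries of `Uᵀ * U` for an upper bidiagonal matrix `U`. -/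
theorem transpose_mul_self_apply_self_of_upperBidiagonal {n : ℕ} {U : Matrix (Fin n) (Fin n) ℝ}
    (hbid : ∀ i j : Fin n, j ≠ i → (j : ℕ) ≠ (i : ℕ) + 1 → U i j = 0)
    {k l : Fin n} (hkl : (l : ℕ) = k + 1) : (Uᵀ * U) l l = U k l ^ 2 + U l l ^ 2 := by
  have hne : k ≠ l := by rintro rfl; omega
  rw [Matrix.mul_apply, Fintype.sum_eq_add k l hne]
  · simp only [Matrix.transpose_apply, sq]
  · rintro i ⟨hik, hil⟩
    have : U i l = 0 := hbid i l (Ne.symm hil) (by have := Fin.val_ne_of_ne hik; omega)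
    simp [this]

/-- Proposition 2: the Cholesky factor of a symmetric, tridiagonal, strictly row
diagonally dominant matrix with positive diagonal is again strictly diagonally dominant. -/
theorem cholesky_factor_of_tridiag_diag_dominant_is_diag_dominant
    (n : ℕ) (hn : 1 ≤ n) (T U : Matrix (Fin n) (Fin n) ℝ)
    (hsymm : T.IsSymm)
    (htri : ∀ i j : Fin n, 1 < |(i : ℤ) - (j : ℤ)| → T i j = 0)
    (hdd : ∀ k : Fin n, ∑ j ∈ Finset.univ.erase k, |T k j| < |T k k|)
    (hTdiag : ∀ k : Fin n, 0 < T k k)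
    (hbid : ∀ i j : Fin n, j ≠ i → (j : ℕ) ≠ (i : ℕ) + 1 → U i j = 0)
    (hUdiag : ∀ k : Fin n, 0 < U k k)
    (hchol : Uᵀ * U = T) :
    ∀ (k : Fin n) (h : (k : ℕ) + 1 < n), |U k ⟨(k : ℕ) + 1, h⟩| < |U k k| := by
  rintro ⟨k, hk⟩ h
  rw [abs_of_pos (hUdiag _)]
  have hoff {i j : Fin n} (hij : (j : ℕ) = i + 1) : |T i j| = U i i * |U i j| := by
    rw [← hchol, transpose_mul_self_apply_succ_of_upperBidiagonal hbid hij, abs_mul,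
      abs_of_pos (hUdiag i)]
  induction k with
  | zero =>
    have hle : |T ⟨0, hk⟩ ⟨0 + 1, h⟩| ≤ ∑ j ∈ Finset.univ.erase ⟨0, hk⟩, |T ⟨0, hk⟩ j| :=
      Finset.single_le_sum (f := fun j => |T ⟨0, hk⟩ j|) (fun _ _ => abs_nonneg _) (by simp)
    have hlt := hle.trans_lt (hdd ⟨0, hk⟩)
    rw [hoff rfl, abs_of_pos (hTdiag _), ← hchol,
      transpose_mul_self_apply_zero_of_upperBidiagonal hbid rfl, sq] at hlt
    exact lt_of_mul_lt_mul_left hlt (hUdiag _).le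
  | succ m ih =>
    have hm : m < n := by omega
    specialize ih hm hk
    set p : Fin n := ⟨m, hm⟩
    set q : Fin n := ⟨m + 1, hk⟩
    set r : Fin n := ⟨m + 1 + 1, h⟩
    have hpr : p ≠ r := by simp [p, r, Fin.ext_iff]; omega
    have hle : |T q p| + |T q r| ≤ ∑ j ∈ Finset.univ.erase q, |T q j| := by
      rw [← Finset.sum_pair (f := fun j => |T q j|) hpr]
      refine Finset.sum_le_sum_of_subset_of_nonneg ?_ fun _ _ _ => abs_nonneg _
      intro j hj
      rcases Finset.mem_insert.1 hj with rfl | hj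
      · simp [p, q]
      · rw [Finset.mem_singleton.1 hj]
        simp [q, r]
    have hlt := hle.trans_lt (hdd q)
    rw [← hsymm.apply q p, hoff (i := p) (j := q) rfl, hoff (i := q) (j := r) rfl,
      abs_of_pos (hTdiag _), ← hchol,
      transpose_mul_self_apply_self_of_upperBidiagonal hbid (k := p) (l := q) rfl] at hlt
    have hsq : U p q ^ 2 ≤ U p p * |U p q| := by
      rw [← sq_abs, sq]
      exact mul_le_mul_of_nonneg_right ih.le (abs_nonneg _)
    refine lt_of_mul_lt_mul_left (a := U q q) ?_ (hUdiag q).le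
    linarith [sq (U q q)]
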